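/- arXiv:2004.06462 — 2 statements merged into one kernel-verified Lean document; each statement's English description precedes it below -/
import Mathlib

section
/- Norm identity for S_y^α (equation NormSalpha): let α > -1, β, η > 0, y ≥ 0, fix I ∈ ℍ with I² = -1, and let φ : (0,∞) → ℍ be measurable with ∫_0^∞ ‖φ(x)‖² x^α e^{-x} dx < ∞. Set a_n = ∫_0^∞ φ_n^α(x) φ(x) x^α e^{-x} dx ∈ ℍ. Then, as an identity in the extended nonnegative reals [0,∞], ∫∫_{{u²+v²<1}} ‖S_y^α φ(u+vI)‖² ω_{β,η}(u²+v²) du dv = π Σ_{n=0}^∞ γ_n^{β,η} φ_n^α(y)² ‖a_n‖². -/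
open MeasureTheory Real Quaternion

/-- Generalized Laguerre polynomial `L_n^{(α)}(x)`. -/
noncomputable def genLaguerre (α : ℝ) (n : ℕ) (x : ℝ) : ℝ :=
  ∑ k ∈ Finset.range (n + 1),
    ((-1 : ℝ) ^ k / (Nat.factorial k)) *
      (Real.Gamma (n + α + 1) / (Real.Gamma (k + α + 1) * (Nat.factorial (n - k)))) * x ^ k

/-- Normalized Laguerre function `φ_n^α(x)`. -/
noncomputable def lagPhi (α : ℝ) (n : ℕ) (x : ℝ) : ℝ :=
  Real.sqrt ((Nat.factorial n : ℝ) / Real.Gamma (n + α + 1)) * genLaguerre α n x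

/-- `γ_n^{β,η} = Γ(η)Γ(β+n)/Γ(β+η+n)`. -/
noncomputable def gamCoef (β η : ℝ) (n : ℕ) : ℝ :=
  Real.Gamma η * Real.Gamma (β + n) / Real.Gamma (β + η + n)

/-- Weight `ω_{β,η}(t) = t^{β-1}(1-t)^{η-1}`. -/
noncomputable def weightBeta (β η t : ℝ) : ℝ := t ^ (β - 1) * (1 - t) ^ (η - 1)

/-- The kernel `R_q^α(x,y) = Σ_n qⁿ φ_n^α(x) φ_n^α(y)`. -/
noncomputable def Rker (α : ℝ) (q : ℍ[ℝ]) (x y : ℝ) : ℍ[ℝ] :=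
  ∑' n : ℕ, (lagPhi α n x * lagPhi α n y) • q ^ n

/-- The dual transform `S_y^α φ(q) = ∫_0^∞ R_q^α(x,y) φ(x) x^α e^{-x} dx`. -/
noncomputable def Sdual (α y : ℝ) (φ : ℝ → ℍ[ℝ]) (q : ℍ[ℝ]) : ℍ[ℝ] :=
  ∫ x in Set.Ioi (0 : ℝ), (x ^ α * Real.exp (-x)) • (Rker α q x y * φ x)

lemma moment_int (α : ℝ) (hα : -1 < α) (k : ℕ) :
    IntegrableOn (fun x : ℝ => x ^ k * (x ^ α * Real.exp (-x))) (Set.Ioi 0) := by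
  have h := Real.GammaIntegral_convergent (s := k + α + 1) (by have := Nat.cast_nonneg (α := ℝ) k; linarith)
  refine h.congr_fun (fun x hx => ?_) measurableSet_Ioi
  have hx : 0 < x := hx
  simp only
  rw [show (k + α + 1 - 1 : ℝ) = k + α by ring, Real.rpow_add hx, Real.rpow_natCast]
  ring

lemma moment_eq (α : ℝ) (hα : -1 < α) (k : ℕ) :
    ∫ x in Set.Ioi (0 : ℝ), x ^ k * (x ^ α * Real.exp (-x)) = Real.Gamma (k + α + 1) := by
  rw [Real.Gamma_eq_integral (by have := Nat.cast_nonneg (α := ℝ) k; linarith)]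
  refine setIntegral_congr_fun measurableSet_Ioi (fun x hx => ?_)
  have hx : 0 < x := hx
  rw [show (k + α + 1 - 1 : ℝ) = k + α by ring, Real.rpow_add hx, Real.rpow_natCast]
  ring

lemma gamma_ascPoch (s : ℝ) (hs : 0 < s) (j : ℕ) :
    Real.Gamma (s + j) = (ascPochhammer ℝ j).eval s * Real.Gamma s := by
  induction j with
  | zero => simp
  | succ j ih =>
    rw [ascPochhammer_succ_right]
    push_cast
    rw [← add_assoc, Real.Gamma_add_one (by positivity), ih]
    simp
    ring

lemma lag_moment_sum (α : ℝ) (hα : -1 < α) (n j : ℕ) (hj : j ≤ n) :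
    ∑ k ∈ Finset.range (n + 1), ((-1 : ℝ) ^ k / (Nat.factorial k)) *
      (Real.Gamma (n + α + 1) / (Real.Gamma (k + α + 1) * (Nat.factorial (n - k)))) *
        Real.Gamma ((k + j : ℕ) + α + 1) =
      if j = n then (-1) ^ n * Real.Gamma (n + α + 1) else 0 := by
  set P : Polynomial ℝ := (ascPochhammer ℝ j).comp (Polynomial.X + Polynomial.C (α + 1)) with hP
  have hdeg : P.natDegree = j := by
    rw [hP, Polynomial.natDegree_comp, ascPochhammer_natDegree, Polynomial.natDegree_X_add_C,
      mul_one]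
  have hmon : P.leadingCoeff = 1 := by
    rw [hP, Polynomial.leadingCoeff_comp (by rw [Polynomial.natDegree_X_add_C]; exact one_ne_zero)]
    rw [(monic_ascPochhammer ℝ j).leadingCoeff, Polynomial.leadingCoeff_X_add_C]; simp
  have hd : (fwdDiff (1 : ℝ))^[n] P.eval 0 = if j = n then (n.factorial : ℝ) else 0 := by
    split_ifs with h
    · have := P.fwdDiff_iter_degree_eq_factorial
      rw [hdeg, h] at this
      rw [this]
      simp [hmon]
    · have := Polynomial.fwdDiff_iter_eq_zero_of_degree_lt (P := P) (n := n) (by rw [hdeg]; omega)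
      rw [this]; rfl
  rw [fwdDiff_iter_eq_sum_shift] at hd
  have key : ∀ k ∈ Finset.range (n + 1), ((-1 : ℝ) ^ k / (Nat.factorial k)) *
      (Real.Gamma (n + α + 1) / (Real.Gamma (k + α + 1) * (Nat.factorial (n - k)))) *
        Real.Gamma ((k + j : ℕ) + α + 1) = ((-1) ^ n * Real.Gamma (n + α + 1) / n.factorial) *
        (((-1 : ℤ) ^ (n - k) * (n.choose k : ℤ)) • P.eval ((0 : ℝ) + k • (1 : ℝ))) := by
    intro k hk
    have hk : k ≤ n := by simpa [Nat.lt_succ_iff] using hk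
    have hpos : 0 < (k : ℝ) + α + 1 := by
      have : (0 : ℝ) ≤ k := by positivity
      linarith
    have h1 : Real.Gamma ((k + j : ℕ) + α + 1) = P.eval (k : ℝ) * Real.Gamma (k + α + 1) := by
      rw [show (((k + j : ℕ) : ℝ) + α + 1) = (k + α + 1) + j by push_cast; ring,
        gamma_ascPoch _ hpos, hP]
      simp [Polynomial.eval_comp, add_assoc]
    have hG : Real.Gamma (k + α + 1) ≠ 0 := (Real.Gamma_pos_of_pos hpos).ne'
    rw [h1]
    have h2 : (n.choose k : ℝ) = n.factorial / (k.factorial * (n - k).factorial) :=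
      Nat.cast_choose ℝ hk
    have h3 : (-1 : ℝ) ^ k = (-1) ^ n * (-1) ^ (n - k) := by
      rw [← pow_add, show n + (n - k) = k + 2 * (n - k) by omega, pow_add, pow_mul]; simp
    simp only [zero_add, nsmul_eq_mul, mul_one, zsmul_eq_mul]
    push_cast
    rw [h2, h3]
    have := Nat.factorial_ne_zero n
    have := Nat.factorial_ne_zero k
    have := Nat.factorial_ne_zero (n - k)
    field_simp
  rw [Finset.sum_congr rfl key, ← Finset.mul_sum, hd]
  split_ifs with h
  · have := Nat.factorial_ne_zero n
    field_simp
  · simp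

lemma lag_moment (α : ℝ) (hα : -1 < α) (n j : ℕ) (hj : j ≤ n) :
    ∫ x in Set.Ioi (0 : ℝ), x ^ j * genLaguerre α n x * (x ^ α * Real.exp (-x)) =
      if j = n then (-1) ^ n * Real.Gamma (n + α + 1) else 0 := by
  rw [← lag_moment_sum α hα n j hj]
  have : ∀ x : ℝ, x ^ j * genLaguerre α n x * (x ^ α * Real.exp (-x)) =
      ∑ k ∈ Finset.range (n + 1), ((-1 : ℝ) ^ k / (Nat.factorial k)) *
      (Real.Gamma (n + α + 1) / (Real.Gamma (k + α + 1) * (Nat.factorial (n - k)))) *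
        (x ^ (k + j) * (x ^ α * Real.exp (-x))) := by
    intro x
    rw [genLaguerre, Finset.mul_sum, Finset.sum_mul]
    refine Finset.sum_congr rfl (fun k _ => ?_)
    ring
  simp_rw [this]
  rw [integral_finsetSum _ (fun k _ => (moment_int α hα (k + j)).const_mul _)]
  refine Finset.sum_congr rfl (fun k _ => ?_)
  rw [integral_const_mul, moment_eq α hα]

lemma lag_moment_integrable (α : ℝ) (hα : -1 < α) (n j : ℕ) :
    IntegrableOn (fun x : ℝ => x ^ j * genLaguerre α n x * (x ^ α * Real.exp (-x)))
      (Set.Ioi 0) := by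
  have : ∀ x : ℝ, x ^ j * genLaguerre α n x * (x ^ α * Real.exp (-x)) =
      ∑ k ∈ Finset.range (n + 1), ((-1 : ℝ) ^ k / (Nat.factorial k)) *
      (Real.Gamma (n + α + 1) / (Real.Gamma (k + α + 1) * (Nat.factorial (n - k)))) *
        (x ^ (k + j) * (x ^ α * Real.exp (-x))) := by
    intro x
    rw [genLaguerre, Finset.mul_sum, Finset.sum_mul]
    refine Finset.sum_congr rfl (fun k _ => ?_)
    ring
  simp_rw [this]
  exact integrable_finsetSum _ (fun k _ => (moment_int α hα (k + j)).const_mul _)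

lemma lag_sq (α : ℝ) (hα : -1 < α) (n : ℕ) :
    IntegrableOn (fun x : ℝ => genLaguerre α n x ^ 2 * (x ^ α * Real.exp (-x))) (Set.Ioi 0) ∧
    ∫ x in Set.Ioi (0 : ℝ), genLaguerre α n x ^ 2 * (x ^ α * Real.exp (-x)) =
      Real.Gamma (n + α + 1) / n.factorial := by
  have : ∀ x : ℝ, genLaguerre α n x ^ 2 * (x ^ α * Real.exp (-x)) =
      ∑ k ∈ Finset.range (n + 1), ((-1 : ℝ) ^ k / (Nat.factorial k)) *
      (Real.Gamma (n + α + 1) / (Real.Gamma (k + α + 1) * (Nat.factorial (n - k)))) *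
        (x ^ k * genLaguerre α n x * (x ^ α * Real.exp (-x))) := by
    intro x
    rw [sq]
    nth_rewrite 1 [genLaguerre]
    rw [Finset.sum_mul, Finset.sum_mul]
    refine Finset.sum_congr rfl (fun k _ => ?_)
    ring
  simp_rw [this]
  refine ⟨integrable_finsetSum _ (fun k _ => (lag_moment_integrable α hα n k).const_mul _), ?_⟩
  rw [integral_finsetSum _ (fun k _ => (lag_moment_integrable α hα n k).const_mul _)]
  simp_rw [integral_const_mul]
  rw [Finset.sum_eq_single_of_mem n (by simp)]
  · rw [lag_moment α hα n n le_rfl, if_pos rfl]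
    have hG : Real.Gamma (n + α + 1) ≠ 0 := (Real.Gamma_pos_of_pos (by have := Nat.cast_nonneg (α := ℝ) n; linarith)).ne'
    have h1 : ((-1 : ℝ) ^ n) * (-1) ^ n = 1 := by rw [← mul_pow]; simp
    simp only [Nat.sub_self, Nat.factorial_zero, Nat.cast_one, mul_one, div_self hG]
    rw [div_mul_eq_mul_div, ← mul_assoc, h1, one_mul]
  · intro k hk hkn
    rw [lag_moment α hα n k (by simpa [Nat.lt_succ_iff] using hk), if_neg hkn, mul_zero]

lemma phi_sq (α : ℝ) (hα : -1 < α) (n : ℕ) :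
    IntegrableOn (fun x : ℝ => lagPhi α n x ^ 2 * (x ^ α * Real.exp (-x))) (Set.Ioi 0) ∧
    ∫ x in Set.Ioi (0 : ℝ), lagPhi α n x ^ 2 * (x ^ α * Real.exp (-x)) = 1 := by
  have hG : 0 < Real.Gamma (n + α + 1) := (Real.Gamma_pos_of_pos (by have := Nat.cast_nonneg (α := ℝ) n; linarith))
  have : ∀ x : ℝ, lagPhi α n x ^ 2 * (x ^ α * Real.exp (-x)) =
      ((Nat.factorial n : ℝ) / Real.Gamma (n + α + 1)) *
        (genLaguerre α n x ^ 2 * (x ^ α * Real.exp (-x))) := by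
    intro x
    rw [lagPhi, mul_pow, Real.sq_sqrt (by positivity)]
    ring
  simp_rw [this]
  refine ⟨(lag_sq α hα n).1.const_mul _, ?_⟩
  rw [integral_const_mul, (lag_sq α hα n).2]
  have := Nat.factorial_ne_zero n
  field_simp

lemma gamma_bound (s r : ℝ) (hs : 0 < s) (hr0 : 0 < r) (hr : r < 1) (m : ℕ) :
    Real.Gamma (m + s) / (Real.Gamma s * m.factorial) ≤ (1 / (1 - r)) ^ s * (1 / r) ^ m := by
  have hGs := Real.Gamma_pos_of_pos hs
  have h1 := Real.integral_rpow_mul_exp_neg_mul_Ioi hs (sub_pos.2 hr)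
  have h2 : Real.Gamma (m + s) * r ^ m / m.factorial ≤ (1 / (1 - r)) ^ s * Real.Gamma s := by
    rw [← h1, Real.Gamma_eq_integral (by positivity), mul_div_assoc, ← integral_mul_const]
    refine setIntegral_mono_on ?_ ?_ measurableSet_Ioi ?_
    · exact (Real.GammaIntegral_convergent (by positivity)).mul_const _
    · by_contra hcon
      rw [integral_undef hcon] at h1
      have : 0 < (1 / (1 - r)) ^ s * Real.Gamma s := by
        have := sub_pos.2 hr
        positivity
      linarith
    · intro x hx
      have hx : 0 < x := hx
      have h3 : (r * x) ^ m / m.factorial ≤ Real.exp (r * x) :=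
        Real.pow_div_factorial_le_exp _ (by positivity) m
      rw [show (m + s - 1 : ℝ) = m + (s - 1) by ring, Real.rpow_add hx, Real.rpow_natCast,
        show -((1 - r) * x) = -x + r * x by ring, Real.exp_add]
      calc _ = (x ^ (s - 1) * Real.exp (-x)) * ((r * x) ^ m / m.factorial) := by
            rw [mul_pow]; ring
        _ ≤ (x ^ (s - 1) * Real.exp (-x)) * Real.exp (r * x) := by gcongr
        _ = _ := by ring
  have hm : (0 : ℝ) < m.factorial := by positivity
  rw [div_le_iff₀ (by positivity)]
  have h4 : Real.Gamma (m + s) = (Real.Gamma (m + s) * r ^ m / m.factorial) *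
      ((1 / r) ^ m * m.factorial) := by
    rw [one_div, inv_pow]; field_simp
  rw [h4]
  calc _ ≤ (1 / (1 - r)) ^ s * Real.Gamma s * ((1 / r) ^ m * m.factorial) := by gcongr
    _ = _ := by ring

lemma lag_bound (α : ℝ) (hα : -1 < α) (y r : ℝ) (hr0 : 0 < r) (hr : r < 1) :
    ∃ C : ℝ, 0 ≤ C ∧ ∀ n, |genLaguerre α n y| ≤ C * (1 / r) ^ n := by
  have h1r := sub_pos.2 hr
  refine ⟨(1 / (1 - r)) ^ (α + 1) * Real.exp (r * |y| / (1 - r)), by positivity, fun n => ?_⟩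
  rw [genLaguerre]
  refine (Finset.abs_sum_le_sum_abs _ _).trans ?_
  have key : ∀ k ∈ Finset.range (n + 1), |((-1 : ℝ) ^ k / (Nat.factorial k)) *
      (Real.Gamma (n + α + 1) / (Real.Gamma (k + α + 1) * (Nat.factorial (n - k)))) * y ^ k| ≤
      (1 / (1 - r)) ^ (α + 1) * (1 / r) ^ n * ((r * |y| / (1 - r)) ^ k / k.factorial) := by
    intro k hk
    have hk : k ≤ n := by simpa [Nat.lt_succ_iff] using hk
    have hpos : 0 < (k : ℝ) + α + 1 := by have := Nat.cast_nonneg (α := ℝ) k; linarith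
    have hposn : 0 < (n : ℝ) + α + 1 := by have := Nat.cast_nonneg (α := ℝ) n; linarith
    have hG := Real.Gamma_pos_of_pos hpos
    have hGn := Real.Gamma_pos_of_pos hposn
    have hb := gamma_bound _ r hpos hr0 hr (n - k)
    rw [show (((n - k : ℕ) : ℝ) + (k + α + 1)) = n + α + 1 by push_cast [hk]; ring] at hb
    rw [abs_mul, abs_mul, abs_div, abs_pow, abs_pow, abs_neg, abs_one, one_pow, Nat.abs_cast,
      abs_of_nonneg (by positivity : 0 ≤ Real.Gamma (n + α + 1) / (Real.Gamma (k + α + 1) * (Nat.factorial (n - k))))]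
    calc _ ≤ 1 / (k.factorial : ℝ) * ((1 / (1 - r)) ^ ((k : ℝ) + α + 1) * (1 / r) ^ (n - k)) *
          |y| ^ k := by gcongr
      _ = _ := by
        rw [show (k : ℝ) + α + 1 = (α + 1) + k by ring, Real.rpow_add (by positivity),
          Real.rpow_natCast]
        have : (1 / r) ^ n = (1 / r) ^ (n - k) * (1 / r) ^ k := by
          rw [← pow_add]; congr 1; omega
        rw [this, div_pow _ _ k, div_pow _ _ k, div_pow _ _ k, mul_pow]
        field_simp
  refine (Finset.sum_le_sum key).trans ?_
  rw [← Finset.mul_sum]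
  have := Real.sum_le_exp_of_nonneg (x := r * |y| / (1 - r)) (by positivity) (n + 1)
  calc _ ≤ (1 / (1 - r)) ^ (α + 1) * (1 / r) ^ n * Real.exp (r * |y| / (1 - r)) := by gcongr
    _ = _ := by ring

lemma ratio_summable (α : ℝ) (hα : -1 < α) (s : ℝ) (hs0 : 0 < s) (hs : s < 1) :
    Summable (fun n : ℕ => s ^ n * ((n.factorial : ℝ) / Real.Gamma (n + α + 1))) := by
  have hG : ∀ n : ℕ, 0 < Real.Gamma (n + α + 1) := fun n =>
    Real.Gamma_pos_of_pos (by have := Nat.cast_nonneg (α := ℝ) n; linarith)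
  refine summable_of_ratio_test_tendsto_lt_one hs (Filter.Eventually.of_forall fun n => ?_) ?_
  · have := hG n
    positivity
  · have h : ∀ n : ℕ, ‖s ^ (n + 1) * (((n + 1).factorial : ℝ) / Real.Gamma ((n + 1 : ℕ) + α + 1))‖ /
        ‖s ^ n * ((n.factorial : ℝ) / Real.Gamma (n + α + 1))‖ = s * (1 - α / (n + (α + 1))) := by
      intro n
      have hp : 0 < (n : ℝ) + α + 1 := by have := Nat.cast_nonneg (α := ℝ) n; linarith
      have h1 := hG n
      have h2 := hG (n + 1)
      rw [Real.norm_of_nonneg (by positivity), Real.norm_of_nonneg (by positivity)]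
      have h3 : Real.Gamma ((n + 1 : ℕ) + α + 1) = (n + α + 1) * Real.Gamma (n + α + 1) := by
        rw [← Real.Gamma_add_one hp.ne']; congr 1; push_cast; ring
      rw [h3, Nat.factorial_succ, pow_succ]
      have h4 : (n : ℝ) + (α + 1) ≠ 0 := by rw [← add_assoc]; exact hp.ne'
      push_cast
      field_simp
      ring
    simp_rw [h]
    have : Filter.Tendsto (fun n : ℕ => s * (1 - α / ((n : ℝ) + (α + 1)))) Filter.atTop
        (nhds (s * (1 - 0))) := by
      refine Filter.Tendsto.const_mul _ (Filter.Tendsto.const_sub _ ?_)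
      refine Filter.Tendsto.const_div_atTop ?_ _
      exact Filter.tendsto_atTop_add_const_right _ _ tendsto_natCast_atTop_atTop
    simpa using this

lemma phi_summable (α : ℝ) (hα : -1 < α) (y ρ : ℝ) (h0 : 0 ≤ ρ) (h1 : ρ < 1) :
    Summable (fun n : ℕ => ρ ^ n * |lagPhi α n y|) := by
  obtain ⟨r, hr0, hr1⟩ := exists_between h1
  have hrp : 0 < r := h0.trans_lt hr0
  obtain ⟨C, hC, hb⟩ := lag_bound α hα y r hrp hr1
  -- compare with s > ρ / r
  have hs1 : ρ / r < 1 := (div_lt_one hrp).2 hr0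
  obtain ⟨s, hs, hs'⟩ := exists_between hs1
  have hs0 : 0 < s := (div_nonneg h0 hrp.le).trans_lt hs
  have hG : ∀ n : ℕ, 0 < Real.Gamma (n + α + 1) := fun n =>
    Real.Gamma_pos_of_pos (by have := Nat.cast_nonneg (α := ℝ) n; linarith)
  have hsum : Summable (fun n : ℕ => C * (s ^ n + s ^ n * ((n.factorial : ℝ) / Real.Gamma (n + α + 1)))) :=
    ((summable_geometric_of_lt_one hs0.le hs').add (ratio_summable α hα s hs0 hs')).mul_left C
  refine Summable.of_nonneg_of_le (fun n => by positivity) (fun n => ?_) hsum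
  have hGn := hG n
  set t := (n.factorial : ℝ) / Real.Gamma (n + α + 1) with ht
  have ht0 : 0 ≤ t := by positivity
  have hsq : Real.sqrt t ≤ 1 + t := by
    nlinarith [Real.sq_sqrt ht0, Real.sqrt_nonneg t, sq_nonneg (Real.sqrt t - 1)]
  rw [lagPhi, abs_mul, abs_of_nonneg (Real.sqrt_nonneg _)]
  calc ρ ^ n * (Real.sqrt t * |genLaguerre α n y|)
      ≤ ρ ^ n * ((1 + t) * (C * (1 / r) ^ n)) := by
        gcongr
        exact hb n
    _ = C * ((ρ / r) ^ n * (1 + t)) := by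
        rw [div_pow, div_pow]; ring
    _ ≤ C * (s ^ n * (1 + t)) := by
        have : 0 ≤ ρ / r := div_nonneg h0 hrp.le
        gcongr
    _ = _ := by ring

lemma genLaguerre_continuous (α : ℝ) (n : ℕ) : Continuous (genLaguerre α n) := by
  unfold genLaguerre
  fun_prop

lemma lagPhi_continuous (α : ℝ) (n : ℕ) : Continuous (lagPhi α n) := by
  unfold lagPhi
  exact continuous_const.mul (genLaguerre_continuous α n)

lemma g_bound (α : ℝ) (hα : -1 < α) (φ : ℝ → ℍ[ℝ])
    (hmeas : AEStronglyMeasurable φ (volume.restrict (Set.Ioi 0)))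
    (hL2 : (∫⁻ x in Set.Ioi (0 : ℝ),
      ENNReal.ofReal (‖φ x‖ ^ 2 * (x ^ α * Real.exp (-x)))) < ⊤) :
    ∃ K : ℝ, ∀ n, IntegrableOn (fun x => (lagPhi α n x * (x ^ α * Real.exp (-x))) • φ x)
        (Set.Ioi 0) ∧
      ∫ x in Set.Ioi (0 : ℝ), ‖(lagPhi α n x * (x ^ α * Real.exp (-x))) • φ x‖ ≤ K := by
  have hwm : Measurable (fun x : ℝ => x ^ α * Real.exp (-x)) := by fun_prop
  have hint : IntegrableOn (fun x => ‖φ x‖ ^ 2 * (x ^ α * Real.exp (-x))) (Set.Ioi 0) := by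
    refine ⟨(hmeas.norm.pow 2).mul hwm.aestronglyMeasurable, ?_⟩
    rw [hasFiniteIntegral_iff_ofReal]
    · exact hL2
    · filter_upwards [ae_restrict_mem measurableSet_Ioi] with x hx
      have hx : 0 < x := hx
      simp only [Pi.zero_apply]
      positivity
  refine ⟨1 + ∫ x in Set.Ioi (0 : ℝ), ‖φ x‖ ^ 2 * (x ^ α * Real.exp (-x)), fun n => ?_⟩
  obtain ⟨hp1, hp2⟩ := phi_sq α hα n
  have hbd : ∀ x ∈ Set.Ioi (0 : ℝ), ‖(lagPhi α n x * (x ^ α * Real.exp (-x))) • φ x‖ ≤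
      lagPhi α n x ^ 2 * (x ^ α * Real.exp (-x)) + ‖φ x‖ ^ 2 * (x ^ α * Real.exp (-x)) := by
    intro x hx
    have hx : 0 < x := hx
    have hw : 0 ≤ x ^ α * Real.exp (-x) := by positivity
    rw [norm_smul, norm_mul, Real.norm_eq_abs, Real.norm_of_nonneg hw, ← add_mul, ← sq_abs]
    have : |lagPhi α n x| * ‖φ x‖ ≤ |lagPhi α n x| ^ 2 + ‖φ x‖ ^ 2 := by
      nlinarith [sq_nonneg (|lagPhi α n x| - ‖φ x‖), sq_nonneg (|lagPhi α n x|),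
        sq_nonneg (‖φ x‖)]
    calc _ = |lagPhi α n x| * ‖φ x‖ * (x ^ α * Real.exp (-x)) := by ring
      _ ≤ _ := by gcongr
  have hI : IntegrableOn (fun x => (lagPhi α n x * (x ^ α * Real.exp (-x))) • φ x)
      (Set.Ioi 0) := by
    refine (hp1.add hint).mono' ?_ ?_
    · exact ((lagPhi_continuous α n).measurable.mul hwm).aestronglyMeasurable.smul hmeas
    · filter_upwards [ae_restrict_mem measurableSet_Ioi] with x hx
      exact hbd x hx
  refine ⟨hI, ?_⟩
  rw [← hp2, ← integral_add hp1 hint]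
  exact setIntegral_mono_on hI.norm (hp1.add hint) measurableSet_Ioi hbd

lemma Sdual_eq (α y : ℝ) (hα : -1 < α) (φ : ℝ → ℍ[ℝ]) (K : ℝ)
    (hK : ∀ n, IntegrableOn (fun x => (lagPhi α n x * (x ^ α * Real.exp (-x))) • φ x)
        (Set.Ioi 0) ∧
      ∫ x in Set.Ioi (0 : ℝ), ‖(lagPhi α n x * (x ^ α * Real.exp (-x))) • φ x‖ ≤ K)
    (q : ℍ[ℝ]) (hq : ‖q‖ < 1) :
    Sdual α y φ q = ∑' n : ℕ, q ^ n * (lagPhi α n y •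
      ∫ x in Set.Ioi (0 : ℝ), (lagPhi α n x * (x ^ α * Real.exp (-x))) • φ x) := by
  have hF : ∀ (n : ℕ) (x : ℝ), (x ^ α * Real.exp (-x)) •
      (((lagPhi α n x * lagPhi α n y) • q ^ n) * φ x) =
      (lagPhi α n y • q ^ n) * ((lagPhi α n x * (x ^ α * Real.exp (-x))) • φ x) := by
    intro n x
    simp only [smul_mul_assoc, mul_smul_comm, smul_smul]
    congr 1
    ring
  have h := hasSum_integral_of_summable_integral_norm (μ := volume.restrict (Set.Ioi (0 : ℝ)))
    (F := fun (n : ℕ) x => (lagPhi α n y • q ^ n) *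
      ((lagPhi α n x * (x ^ α * Real.exp (-x))) • φ x))
    (fun n => (hK n).1.const_mul _) ?_
  · have h1 : Sdual α y φ q = ∫ x in Set.Ioi (0 : ℝ), ∑' n : ℕ, (lagPhi α n y • q ^ n) *
      ((lagPhi α n x * (x ^ α * Real.exp (-x))) • φ x) := by
      unfold Sdual
      congr 1
      ext1 x
      simp_rw [← hF]
      rw [Rker, ← tsum_mul_right, tsum_const_smul'']
    rw [h1, ← h.tsum_eq]
    congr 1
    ext1 n
    rw [integral_const_mul_of_integrable (hK n).1]
    simp only [smul_mul_assoc, mul_smul_comm]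
  · simp_rw [norm_mul, integral_const_mul]
    refine Summable.of_nonneg_of_le (fun n => by positivity) (fun n => ?_)
      ((phi_summable α hα y ‖q‖ (norm_nonneg _) hq).mul_right K)
    rw [norm_smul, norm_pow, Real.norm_eq_abs, mul_comm |_|]
    have := (hK n).2
    gcongr

lemma I_props (I : ℍ[ℝ]) (hI : I ^ 2 = -1) :
    I.re = 0 ∧ I.imI ^ 2 + I.imJ ^ 2 + I.imK ^ 2 = 1 := by
  rw [sq] at hI
  have h0 := congrArg (fun q : ℍ[ℝ] => q.re) hI
  have h1 := congrArg (fun q : ℍ[ℝ] => q.imI) hI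
  have h2 := congrArg (fun q : ℍ[ℝ] => q.imJ) hI
  have h3 := congrArg (fun q : ℍ[ℝ] => q.imK) hI
  simp at h0 h1 h2 h3
  have hr : I.re = 0 := by
    by_contra hne
    have e1 : I.imI = 0 := by
      have : I.re * I.imI = 0 := by linarith
      simpa [hne] using this
    have e2 : I.imJ = 0 := by
      have : I.re * I.imJ = 0 := by linarith
      simpa [hne] using this
    have e3 : I.imK = 0 := by
      have : I.re * I.imK = 0 := by linarith
      simpa [hne] using this
    rw [e1, e2, e3] at h0
    nlinarith
  refine ⟨hr, ?_⟩
  rw [hr] at h0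
  linarith

/-- `cos t + sin t I`. -/
noncomputable def Ecis (I : ℍ[ℝ]) (t : ℝ) : ℍ[ℝ] := (Real.cos t : ℍ[ℝ]) + Real.sin t • I

lemma Ecis_continuous (I : ℍ[ℝ]) : Continuous (Ecis I) := by
  unfold Ecis
  have : Continuous (fun t : ℝ => (Real.cos t : ℍ[ℝ])) :=
    Quaternion.continuous_coe.comp Real.continuous_cos
  exact this.add (Real.continuous_sin.smul continuous_const)

lemma Ecis_add (I : ℍ[ℝ]) (hI : I ^ 2 = -1) (s t : ℝ) : Ecis I (s + t) = Ecis I s * Ecis I t := by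
  unfold Ecis
  rw [Real.cos_add, Real.sin_add]
  have h : I * I = -1 := by rw [← sq]; exact hI
  simp only [add_mul, mul_add, smul_mul_assoc, mul_smul_comm, h, Quaternion.coe_mul,
    Quaternion.coe_sub, Quaternion.coe_mul_eq_smul, Quaternion.mul_coe_eq_smul, smul_smul, add_smul]
  ext <;> simp <;> ring

lemma Ecis_pow (I : ℍ[ℝ]) (hI : I ^ 2 = -1) (n : ℕ) (t : ℝ) :
    Ecis I t ^ n = Ecis I (n * t) := by
  induction n with
  | zero => simp [Ecis]
  | succ n ih => rw [pow_succ, ih, ← Ecis_add I hI]; congr 1; push_cast; ring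

lemma Ecis_inner (I : ℍ[ℝ]) (hI : I ^ 2 = -1) (s t : ℝ) (d e : ℍ[ℝ]) :
    inner ℝ (Ecis I s * d) (Ecis I t * e) =
      Real.cos (s - t) * (d * star e).re + Real.sin (s - t) * (I * (d * star e)).re := by
  obtain ⟨h0, h1⟩ := I_props I hI
  rw [Quaternion.inner_def, Real.cos_sub, Real.sin_sub]
  simp [Ecis, h0]
  linear_combination (Real.sin s * Real.sin t * (d.re * e.re + d.imI * e.imI + d.imJ * e.imJ +
    d.imK * e.imK)) * h1

lemma Ecis_norm (I : ℍ[ℝ]) (hI : I ^ 2 = -1) (t : ℝ) : ‖Ecis I t‖ = 1 := by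
  have h := Ecis_inner I hI t t 1 1
  rw [real_inner_self_eq_norm_sq] at h
  simp at h
  rcases h with h | h
  · exact h
  · linarith [norm_nonneg (Ecis I t)]

lemma hasSum_helper (F : ℕ → ℝ → ℝ) (hF : ∀ n, Continuous (F n)) (b : ℕ → ℝ) (hb : Summable b)
    (hFb : ∀ n t, |F n t| ≤ b n) :
    HasSum (fun n => ∫ t in Set.Ioo (-π) π, F n t) (∫ t in Set.Ioo (-π) π, ∑' n, F n t) := by
  refine hasSum_integral_of_summable_integral_norm
    (fun n => ((hF n).integrableOn_Icc).mono_set Set.Ioo_subset_Icc_self) ?_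
  refine Summable.of_nonneg_of_le (fun n => integral_nonneg fun t => norm_nonneg _) (fun n => ?_)
    (hb.mul_right (2 * π))
  have : ∫ t in Set.Ioo (-π) π, ‖F n t‖ ≤ ∫ t in Set.Ioo (-π) π, b n := by
    refine integral_mono (((hF n).norm.integrableOn_Icc).mono_set Set.Ioo_subset_Icc_self) ?_ ?_
    · simp
    · intro t; exact hFb n t
  refine this.trans (le_of_eq ?_)
  have hp := Real.pi_pos
  simp [Measure.real, ENNReal.toReal_ofReal, hp.le, two_mul]
  ring

lemma int_cos_sin (k : ℤ) (hk : k ≠ 0) (A B : ℝ) :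
    ∫ t in Set.Ioo (-π) π, (Real.cos (k * t) * A + Real.sin (k * t) * B) = 0 := by
  have hk' : (k : ℝ) ≠ 0 := by exact_mod_cast hk
  have hp := Real.pi_pos
  rw [← integral_Ioc_eq_integral_Ioo, ← intervalIntegral.integral_of_le (by linarith)]
  rw [intervalIntegral.integral_add, intervalIntegral.integral_mul_const,
    intervalIntegral.integral_mul_const, intervalIntegral.integral_comp_mul_left _ hk',
    intervalIntegral.integral_comp_mul_left _ hk']
  · simp [Real.sin_int_mul_pi]
  · exact Continuous.intervalIntegrable (by fun_prop) _ _
  · exact Continuous.intervalIntegrable (by fun_prop) _ _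

lemma parseval (I : ℍ[ℝ]) (hI : I ^ 2 = -1) (d : ℕ → ℍ[ℝ]) (hd : Summable fun n => ‖d n‖) :
    Continuous (fun t : ℝ => ∑' n : ℕ, Ecis I (n * t) * d n) ∧
    HasSum (fun n => 2 * π * ‖d n‖ ^ 2)
      (∫ t in Set.Ioo (-π) π, ‖∑' n : ℕ, Ecis I (n * t) * d n‖ ^ 2) := by
  have hE := Ecis_continuous I
  have hterm : ∀ n : ℕ, Continuous (fun t : ℝ => Ecis I (n * t) * d n) := fun n =>
    (hE.comp (continuous_const.mul continuous_id)).mul continuous_const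
  have hnorm : ∀ (n : ℕ) (t : ℝ), ‖Ecis I (n * t) * d n‖ = ‖d n‖ := fun n t => by
    rw [norm_mul, Ecis_norm I hI, one_mul]
  have hcont : Continuous (fun t : ℝ => ∑' n : ℕ, Ecis I (n * t) * d n) :=
    continuous_tsum hterm hd (fun n t => (hnorm n t).le)
  refine ⟨hcont, ?_⟩
  set f := fun t : ℝ => ∑' n : ℕ, Ecis I (n * t) * d n with hf
  have hsum : ∀ t : ℝ, HasSum (fun n : ℕ => Ecis I (n * t) * d n) (f t) := fun t =>
    (Summable.of_norm (by simpa only [hnorm] using hd)).hasSum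
  have hfb : ∀ t, ‖f t‖ ≤ ∑' n, ‖d n‖ := fun t =>
    tsum_of_norm_bounded hd.hasSum (fun n => (hnorm n t).le)
  have h1 : ∀ n : ℕ, ∫ t in Set.Ioo (-π) π, inner ℝ (f t) (Ecis I (n * t) * d n) =
      2 * π * ‖d n‖ ^ 2 := by
    intro n
    have hs := hasSum_helper (fun m t => inner ℝ (Ecis I (m * t) * d m) (Ecis I (n * t) * d n))
      (fun m => (hterm m).inner (hterm n)) (fun m => ‖d m‖ * ‖d n‖) (hd.mul_right _)
      (fun m t => by
        have := abs_real_inner_le_norm (Ecis I (m * t) * d m) (Ecis I (n * t) * d n)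
        rwa [hnorm, hnorm] at this)
    have he : ∀ t, ∑' m : ℕ, inner ℝ (Ecis I (m * t) * d m) (Ecis I (n * t) * d n) =
        inner ℝ (f t) (Ecis I (n * t) * d n) := by
      intro t
      have := (hsum t).mapL (innerSL ℝ (Ecis I (n * t) * d n))
      simp only [innerSL_apply_apply] at this
      rw [real_inner_comm, ← this.tsum_eq]
      congr 1
      ext1 m
      rw [real_inner_comm]
    simp_rw [he] at hs
    refine hs.unique ?_
    have hz : ∀ m, m ≠ n → ∫ t in Set.Ioo (-π) π,
        inner ℝ (Ecis I (m * t) * d m) (Ecis I (n * t) * d n) = 0 := by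
      intro m hm
      simp_rw [Ecis_inner I hI]
      have := int_cos_sin ((m : ℤ) - n) (by omega) (d m * star (d n)).re
        (I * (d m * star (d n))).re
      push_cast at this
      simp_rw [← sub_mul]
      exact this
    have hn : ∫ t in Set.Ioo (-π) π,
        inner ℝ (Ecis I (n * t) * d n) (Ecis I (n * t) * d n) = 2 * π * ‖d n‖ ^ 2 := by
      simp_rw [real_inner_self_eq_norm_sq, hnorm]
      have hp := Real.pi_pos
      simp [Measure.real, ENNReal.toReal_ofReal, hp.le, two_mul]
    rw [← hn]
    exact hasSum_single n hz
  have hs := hasSum_helper (fun n t => inner ℝ (f t) (Ecis I (n * t) * d n))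
      (fun m => hcont.inner (hterm m)) (fun m => (∑' n, ‖d n‖) * ‖d m‖) (hd.mul_left _)
      (fun m t => by
        have := abs_real_inner_le_norm (f t) (Ecis I (m * t) * d m)
        rw [hnorm] at this
        exact this.trans (by gcongr; exact hfb t))
  simp_rw [h1] at hs
  convert hs using 3 with t
  rw [← real_inner_self_eq_norm_sq]
  have := (hsum t).mapL (innerSL ℝ (f t))
  simp only [innerSL_apply_apply] at this
  exact this.tsum_eq.symm

lemma beta_lint (β η : ℝ) (hβ : 0 < β) (hη : 0 < η) (n : ℕ) :
    ∫⁻ r in Set.Ioo (0 : ℝ) 1, ENNReal.ofReal (2 * r * weightBeta β η (r ^ 2) * (r ^ n) ^ 2) =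
      ENNReal.ofReal (gamCoef β η n) := by
  have hβn : 0 < β + n := by positivity
  have hb := ProbabilityTheory.beta_pos hβn hη
  have h1 := ProbabilityTheory.lintegral_betaPDF_eq_one hβn hη
  rw [ProbabilityTheory.lintegral_betaPDF] at h1
  have him : (fun r : ℝ => r ^ 2) '' Set.Ioo 0 1 = Set.Ioo 0 1 := by
    ext t
    constructor
    · rintro ⟨r, ⟨h0, h1⟩, rfl⟩
      exact ⟨by positivity, by simp only; nlinarith⟩
    · rintro ⟨h0, h1⟩
      refine ⟨Real.sqrt t, ⟨Real.sqrt_pos.2 h0, ?_⟩, Real.sq_sqrt h0.le⟩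
      rw [Real.sqrt_lt' one_pos]; simpa using h1
  have hcv := lintegral_image_eq_lintegral_abs_deriv_mul (s := Set.Ioo (0 : ℝ) 1)
    (f := fun r : ℝ => r ^ 2) (f' := fun r => 2 * r) measurableSet_Ioo
    (fun r _ => by simpa using (hasDerivAt_pow 2 r).hasDerivWithinAt)
    (fun a ha b hb hab => by
      exact (pow_left_inj₀ ha.1.le hb.1.le two_ne_zero).1 hab)
    (fun x => ENNReal.ofReal (1 / ProbabilityTheory.beta (β + n) η * x ^ (β + n - 1) * (1 - x) ^ (η - 1)))
  rw [him, h1] at hcv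
  have hg : gamCoef β η n = ProbabilityTheory.beta (β + n) η := by
    unfold gamCoef ProbabilityTheory.beta
    rw [mul_comm, show β + η + n = β + n + η by ring]
  rw [hg, ← mul_one (ENNReal.ofReal _), hcv, ← lintegral_const_mul' _ _ ENNReal.ofReal_ne_top]
  refine setLIntegral_congr_fun measurableSet_Ioo (fun r hr => ?_)
  have hr0 : 0 < r := hr.1
  rw [← ENNReal.ofReal_mul (abs_nonneg _), ← ENNReal.ofReal_mul hb.le, abs_of_pos (by positivity)]
  congr 1
  rw [weightBeta, show β + n - 1 = β - 1 + n by ring, Real.rpow_add (by positivity),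
    Real.rpow_natCast]
  field_simp
  rw [← pow_mul, ← pow_mul, mul_comm n 2]

lemma disc_lemma (β η : ℝ) (hβ : 0 < β) (hη : 0 < η) (I : ℍ[ℝ]) (hI : I ^ 2 = -1)
    (c : ℕ → ℍ[ℝ]) (hc : ∀ ρ : ℝ, 0 ≤ ρ → ρ < 1 → Summable fun n => ρ ^ n * ‖c n‖) :
    (∫⁻ p in {p : ℝ × ℝ | p.1 ^ 2 + p.2 ^ 2 < 1},
        ENNReal.ofReal (‖∑' n : ℕ, ((p.1 : ℍ[ℝ]) + p.2 • I) ^ n * c n‖ ^ 2 *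
          weightBeta β η (p.1 ^ 2 + p.2 ^ 2))) =
    ENNReal.ofReal π * ∑' n : ℕ, ENNReal.ofReal (gamCoef β η n * ‖c n‖ ^ 2) := by
  have hDm : MeasurableSet {p : ℝ × ℝ | p.1 ^ 2 + p.2 ^ 2 < 1} :=
    measurableSet_lt (by fun_prop) (by fun_prop)
  rw [← lintegral_indicator hDm, ← lintegral_comp_polarCoord_symm]
  set h : ℝ → ℝ → ENNReal := fun r t => ENNReal.ofReal (r * weightBeta β η (r ^ 2)) *
    ENNReal.ofReal (‖∑' n : ℕ, Ecis I (n * t) * ((r ^ n) • c n)‖ ^ 2) with hh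
  have hwm : Measurable (fun r : ℝ => r * weightBeta β η (r ^ 2)) := by
    unfold weightBeta; fun_prop
  have hw0 : ∀ r ∈ Set.Ioo (0 : ℝ) 1, 0 ≤ r * weightBeta β η (r ^ 2) := by
    intro r hr
    have h0 : 0 < r := hr.1
    have h1 : 0 < 1 - r ^ 2 := by nlinarith [hr.2]
    unfold weightBeta
    positivity
  have hd : ∀ r ∈ Set.Ioo (0 : ℝ) 1, Summable fun n => ‖(r ^ n) • c n‖ := by
    intro r hr
    have := hc r hr.1.le hr.2
    refine this.congr fun n => ?_
    rw [norm_smul, Real.norm_of_nonneg (by have := hr.1; positivity)]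
  have hsm : MeasurableSet (Set.Ioo (0 : ℝ) 1 ×ˢ Set.Ioo (-π) π) :=
    measurableSet_Ioo.prod measurableSet_Ioo
  have step1 : (∫⁻ p in polarCoord.target, ENNReal.ofReal p.1 •
      Set.indicator {p : ℝ × ℝ | p.1 ^ 2 + p.2 ^ 2 < 1} (fun p =>
        ENNReal.ofReal (‖∑' n : ℕ, ((p.1 : ℍ[ℝ]) + p.2 • I) ^ n * c n‖ ^ 2 *
          weightBeta β η (p.1 ^ 2 + p.2 ^ 2))) (polarCoord.symm p)) =
      ∫⁻ p in Set.Ioo (0 : ℝ) 1 ×ˢ Set.Ioo (-π) π, h p.1 p.2 := by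
    rw [← lintegral_indicator hsm, ← lintegral_indicator polarCoord.open_target.measurableSet]
    congr 1
    ext1 p
    obtain ⟨r, t⟩ := p
    have hsq : (r * Real.cos t) ^ 2 + (r * Real.sin t) ^ 2 = r ^ 2 := by
      nlinarith [Real.sin_sq_add_cos_sq t]
    by_cases hm : (r, t) ∈ polarCoord.target
    · rw [Set.indicator_of_mem hm]
      rw [polarCoord_target] at hm
      have hr0 : 0 < r := hm.1
      have ht := hm.2
      by_cases hr1 : r < 1
      · have hmem : (r, t) ∈ Set.Ioo (0 : ℝ) 1 ×ˢ Set.Ioo (-π) π := ⟨⟨hr0, hr1⟩, ht⟩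
        rw [Set.indicator_of_mem hmem, Set.indicator_of_mem]
        · simp only [polarCoord_symm_apply, hsq, hh, smul_eq_mul]
          have hterm : ∀ n : ℕ, (((r * Real.cos t : ℝ) : ℍ[ℝ]) + (r * Real.sin t) • I) ^ n * c n =
              Ecis I (n * t) * ((r ^ n) • c n) := by
            intro n
            have : ((r * Real.cos t : ℝ) : ℍ[ℝ]) + (r * Real.sin t) • I = r • Ecis I t := by
              rw [Ecis, smul_add, smul_smul, Quaternion.smul_coe]
            rw [this, smul_pow, Ecis_pow I hI, smul_mul_assoc, mul_smul_comm]
          simp_rw [hterm]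
          rw [← ENNReal.ofReal_mul hr0.le, ← ENNReal.ofReal_mul (hw0 r ⟨hr0, hr1⟩)]
          congr 1
          ring
        · simp only [polarCoord_symm_apply, Set.mem_ofPred_eq, hsq]
          nlinarith
      · rw [Set.indicator_of_notMem, Set.indicator_of_notMem, smul_zero]
        · rintro ⟨⟨_, h2⟩, _⟩
          exact hr1 h2
        · simp only [polarCoord_symm_apply, Set.mem_ofPred_eq, hsq]
          nlinarith
    · rw [Set.indicator_of_notMem hm, Set.indicator_of_notMem]
      rintro ⟨⟨h1, _⟩, h2⟩
      exact hm (by rw [polarCoord_target]; exact ⟨h1, h2⟩)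
  rw [step1]
  have hvol : (volume : Measure (ℝ × ℝ)).restrict (Set.Ioo (0 : ℝ) 1 ×ˢ Set.Ioo (-π) π) =
      ((volume : Measure ℝ).restrict (Set.Ioo 0 1)).prod
        ((volume : Measure ℝ).restrict (Set.Ioo (-π) π)) := by
    rw [Measure.prod_restrict]; rfl
  have hae : AEMeasurable (fun p : ℝ × ℝ => h p.1 p.2)
      ((volume : Measure (ℝ × ℝ)).restrict (Set.Ioo (0 : ℝ) 1 ×ˢ Set.Ioo (-π) π)) := by
    have hA : AEMeasurable (fun p : ℝ × ℝ => ENNReal.ofReal (p.1 * weightBeta β η (p.1 ^ 2)))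
        ((volume : Measure (ℝ × ℝ)).restrict (Set.Ioo (0 : ℝ) 1 ×ˢ Set.Ioo (-π) π)) :=
      (ENNReal.measurable_ofReal.comp (hwm.comp measurable_fst)).aemeasurable
    have hB : AEMeasurable (fun p : ℝ × ℝ =>
        ENNReal.ofReal (‖∑' n : ℕ, Ecis I (n * p.2) * ((p.1 ^ n) • c n)‖ ^ 2))
        ((volume : Measure (ℝ × ℝ)).restrict (Set.Ioo (0 : ℝ) 1 ×ˢ Set.Ioo (-π) π)) := by
      refine ENNReal.measurable_ofReal.comp_aemeasurable ?_
      refine aemeasurable_of_tendsto_metrizable_ae Filter.atTop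
        (f := fun (N : ℕ) (p : ℝ × ℝ) =>
          ‖∑ n ∈ Finset.range N, Ecis I (n * p.2) * ((p.1 ^ n) • c n)‖ ^ 2) ?_ ?_
      · intro N
        refine Continuous.aemeasurable ?_
        refine (Continuous.norm (continuous_finset_sum _ fun n _ => ?_)).pow 2
        have hE := Ecis_continuous I
        exact (hE.comp (continuous_const.mul continuous_snd)).mul
          ((continuous_fst.pow n).smul continuous_const)
      · filter_upwards [ae_restrict_mem hsm] with p hp
        have hs : Summable (fun n : ℕ => Ecis I (n * p.2) * ((p.1 ^ n) • c n)) := by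
          refine Summable.of_norm ((hd p.1 hp.1).congr fun n => ?_)
          rw [norm_mul, Ecis_norm I hI, one_mul]
        exact (hs.hasSum.tendsto_sum_nat.norm).pow 2
    exact hA.mul hB
  rw [hvol, lintegral_prod _ (by rw [← hvol]; exact hae)]
  have hinner : ∀ r ∈ Set.Ioo (0 : ℝ) 1, ∫⁻ t in Set.Ioo (-π) π, h r t =
      ∑' n : ℕ, ENNReal.ofReal (π * ‖c n‖ ^ 2) *
        ENNReal.ofReal (2 * r * weightBeta β η (r ^ 2) * (r ^ n) ^ 2) := by
    intro r hr
    obtain ⟨hcont, hps⟩ := parseval I hI (fun n => (r ^ n) • c n) (hd r hr)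
    simp only [hh]
    rw [lintegral_const_mul' _ _ ENNReal.ofReal_ne_top, ← ofReal_integral_eq_lintegral_ofReal,
      ← hps.tsum_eq, ENNReal.ofReal_tsum_of_nonneg, ← ENNReal.tsum_mul_left]
    · congr 1
      ext1 n
      rw [← ENNReal.ofReal_mul (hw0 r hr), ← ENNReal.ofReal_mul (by positivity)]
      congr 1
      rw [norm_smul, Real.norm_of_nonneg (by have := hr.1; positivity)]
      ring
    · intro n; positivity
    · exact hps.summable
    · exact ((hcont.norm.pow 2).integrableOn_Icc).mono_set Set.Ioo_subset_Icc_self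
    · exact Filter.Eventually.of_forall fun t => by positivity
  rw [setLIntegral_congr_fun measurableSet_Ioo hinner, lintegral_tsum, ← ENNReal.tsum_mul_left]
  · congr 1
    ext1 n
    rw [lintegral_const_mul' _ _ ENNReal.ofReal_ne_top, beta_lint β η hβ hη,
      ENNReal.ofReal_mul Real.pi_pos.le, mul_assoc, ← ENNReal.ofReal_mul (by positivity),
      mul_comm (‖c n‖ ^ 2)]
  · intro n
    refine (Measurable.const_mul (ENNReal.measurable_ofReal.comp ?_) _).aemeasurable
    unfold weightBeta
    fun_prop

/-- Norm identity (equation NormSalpha), as an identity in `[0,∞]`: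
`‖S_y^α φ‖²_{ω_{β,η}} = π Σ_n γ_n^{β,η} φ_n^α(y)² ‖a_n‖²` where
`a_n = ∫_0^∞ φ_n^α(x) φ(x) x^α e^{-x} dx`. -/
theorem stmt_9 (α β η y : ℝ) (hα : -1 < α) (hβ : 0 < β) (hη : 0 < η) (hy : 0 ≤ y)
    (I : ℍ[ℝ]) (hI : I ^ 2 = -1) (φ : ℝ → ℍ[ℝ])
    (hmeas : AEStronglyMeasurable φ (volume.restrict (Set.Ioi 0)))
    (hL2 : (∫⁻ x in Set.Ioi (0 : ℝ),
      ENNReal.ofReal (‖φ x‖ ^ 2 * (x ^ α * Real.exp (-x)))) < ⊤) :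
    (∫⁻ p in {p : ℝ × ℝ | p.1 ^ 2 + p.2 ^ 2 < 1},
        ENNReal.ofReal (‖Sdual α y φ ((p.1 : ℍ[ℝ]) + p.2 • I)‖ ^ 2 *
          weightBeta β η (p.1 ^ 2 + p.2 ^ 2))) =
    ENNReal.ofReal π *
      ∑' n : ℕ, ENNReal.ofReal (gamCoef β η n * (lagPhi α n y) ^ 2 *
        ‖∫ x in Set.Ioi (0 : ℝ), (lagPhi α n x * (x ^ α * Real.exp (-x))) • φ x‖ ^ 2) := by
  obtain ⟨K, hK⟩ := g_bound α hα φ hmeas hL2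
  have hIn := I_props I hI
  set a : ℕ → ℍ[ℝ] := fun n =>
    ∫ x in Set.Ioi (0 : ℝ), (lagPhi α n x * (x ^ α * Real.exp (-x))) • φ x with ha
  have haK : ∀ n, ‖a n‖ ≤ K := fun n => (norm_integral_le_integral_norm _).trans (hK n).2
  have hmain := disc_lemma β η hβ hη I hI (fun n => lagPhi α n y • a n) (by
    intro ρ h0 h1
    refine Summable.of_nonneg_of_le (fun n => by positivity) (fun n => ?_)
      ((phi_summable α hα y ρ h0 h1).mul_right K)
    rw [norm_smul, Real.norm_eq_abs, ← mul_assoc]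
    have := haK n
    gcongr)
  have hDm : MeasurableSet {p : ℝ × ℝ | p.1 ^ 2 + p.2 ^ 2 < 1} :=
    measurableSet_lt (by fun_prop) (by fun_prop)
  have hL : ∀ p ∈ {p : ℝ × ℝ | p.1 ^ 2 + p.2 ^ 2 < 1},
      ENNReal.ofReal (‖Sdual α y φ ((p.1 : ℍ[ℝ]) + p.2 • I)‖ ^ 2 *
          weightBeta β η (p.1 ^ 2 + p.2 ^ 2)) =
      ENNReal.ofReal (‖∑' n : ℕ, ((p.1 : ℍ[ℝ]) + p.2 • I) ^ n * (lagPhi α n y • a n)‖ ^ 2 *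
          weightBeta β η (p.1 ^ 2 + p.2 ^ 2)) := by
    intro p hp
    have hp : p.1 ^ 2 + p.2 ^ 2 < 1 := hp
    have hq : ‖(p.1 : ℍ[ℝ]) + p.2 • I‖ < 1 := by
      have h1 : ‖(p.1 : ℍ[ℝ]) + p.2 • I‖ * ‖(p.1 : ℍ[ℝ]) + p.2 • I‖ = p.1 ^ 2 + p.2 ^ 2 := by
        rw [← Quaternion.normSq_eq_norm_mul_self, Quaternion.normSq_def']
        simp [hIn.1]
        linear_combination p.2 ^ 2 * hIn.2
      nlinarith [norm_nonneg ((p.1 : ℍ[ℝ]) + p.2 • I)]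
    rw [Sdual_eq α y hα φ K hK _ hq]
  rw [setLIntegral_congr_fun hDm hL, hmain]
  congr 2
  ext1 n
  rw [norm_smul, mul_pow, Real.norm_eq_abs, sq_abs, mul_assoc]
end

section
/- Orthogonality of the images of the Laguerre basis (singular values of S_y^α, Proposition propsv): let α > -1, β, η > 0, y ≥ 0, and fix I ∈ ℍ with I² = -1. Then for all m, n ∈ ℕ, ∫∫_{{u²+v²<1}} conj(S_y^α φ_m^α(u+vI)) · S_y^α φ_n^α(u+vI) · ω_{β,η}(u²+v²) du dv = δ_{m,n} · π γ_n^{β,η} φ_n^α(y)². Consequently the singular values of S_y^α are |s_{n,y}^α| = (π γ_n^{β,η})^{1/2} |φ_n^α(y)|. -/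
open MeasureTheory Real Quaternion

lemma aux_asc (a : ℝ) (ha : 0 < a) (p : ℕ) :
    (ascPochhammer ℝ p).eval a * Real.Gamma a = Real.Gamma (a + p) := by
  induction p with
  | zero => simp
  | succ p ih =>
    rw [ascPochhammer_succ_eval]
    have h : (0:ℝ) < a + p := by positivity
    push_cast
    rw [← add_assoc, Real.Gamma_add_one h.ne', ← ih]
    ring

lemma aux_sum (a : ℝ) (n p : ℕ) (hp : p ≤ n) :
    ∑ k ∈ Finset.range (n + 1), (-1 : ℝ) ^ k * (n.choose k : ℝ) * (ascPochhammer ℝ p).eval (a + k)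
      = if p = n then (-1 : ℝ) ^ n * (n.factorial : ℝ) else 0 := by
  have key := fwdDiff_iter_eq_sum_shift (1 : ℝ) (ascPochhammer ℝ p).eval n a
  have h2 : ∑ k ∈ Finset.range (n + 1),
      (-1 : ℝ) ^ k * (n.choose k : ℝ) * (ascPochhammer ℝ p).eval (a + k)
      = (-1 : ℝ) ^ n * (fwdDiff (1 : ℝ))^[n] (ascPochhammer ℝ p).eval a := by
    rw [key, Finset.mul_sum]
    refine Finset.sum_congr rfl fun k hk => ?_
    have hk' : k ≤ n := Nat.lt_succ_iff.mp (Finset.mem_range.mp hk)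
    obtain ⟨j, rfl⟩ := Nat.exists_eq_add_of_le hk'
    have h1 : (-1 : ℝ) ^ j * (-1 : ℝ) ^ j = 1 := by
      rw [← mul_pow]; norm_num
    simp only [Nat.add_sub_cancel_left, nsmul_eq_mul, mul_one, zsmul_eq_mul, Int.cast_mul,
      Int.cast_pow, Int.cast_neg, Int.cast_one, Int.cast_natCast, pow_add]
    linear_combination (-1 : ℝ) ^ k * ((k + j).choose k : ℝ) *
      (ascPochhammer ℝ p).eval (a + k) * (-h1)
  rw [h2]
  have hd : (ascPochhammer ℝ p).natDegree = p := ascPochhammer_natDegree ℝ p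
  split_ifs with h
  · subst h
    have := Polynomial.fwdDiff_iter_degree_eq_factorial (ascPochhammer ℝ p)
    rw [hd] at this
    rw [this, (monic_ascPochhammer ℝ p).leadingCoeff]
    simp
  · rw [Polynomial.fwdDiff_iter_eq_zero_of_degree_lt (by rw [hd]; omega)]
    simp

/-- the weight measure integrals -/
lemma aux_int_pow (α : ℝ) (hα : -1 < α) (k : ℕ) :
    IntegrableOn (fun x : ℝ => (x ^ α * Real.exp (-x)) * x ^ k) (Set.Ioi 0) ∧
    ∫ x in Set.Ioi (0:ℝ), (x ^ α * Real.exp (-x)) * x ^ k = Real.Gamma (k + α + 1) := by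
  have hpos : 0 < (k : ℝ) + α + 1 := by have : (0:ℝ) ≤ k := by positivity
                                        linarith
  have he : Set.EqOn (fun x : ℝ => Real.exp (-x) * x ^ ((k : ℝ) + α + 1 - 1))
      (fun x : ℝ => (x ^ α * Real.exp (-x)) * x ^ k) (Set.Ioi 0) := by
    intro x hx
    simp only
    rw [show (k : ℝ) + α + 1 - 1 = α + k by ring, Real.rpow_add hx, Real.rpow_natCast]
    ring
  refine ⟨(Real.GammaIntegral_convergent hpos).congr_fun he measurableSet_Ioi, ?_⟩
  rw [Real.Gamma_eq_integral hpos]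
  exact (setIntegral_congr_fun measurableSet_Ioi he).symm

/-- coefficients -/
noncomputable def lagC (α : ℝ) (n k : ℕ) : ℝ := ((-1 : ℝ) ^ k / (Nat.factorial k)) *
      (Real.Gamma (n + α + 1) / (Real.Gamma (k + α + 1) * (Nat.factorial (n - k))))

lemma genLaguerre_eq (α : ℝ) (n : ℕ) (x : ℝ) :
    genLaguerre α n x = ∑ k ∈ Finset.range (n + 1), lagC α n k * x ^ k := rfl

lemma aux_int_pow_lag (α : ℝ) (hα : -1 < α) (n p : ℕ) :
    IntegrableOn (fun x : ℝ => (x ^ α * Real.exp (-x)) * (x ^ p * genLaguerre α n x))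
      (Set.Ioi 0) ∧
    (p ≤ n → ∫ x in Set.Ioi (0:ℝ), (x ^ α * Real.exp (-x)) * (x ^ p * genLaguerre α n x) =
      if p = n then (-1 : ℝ) ^ n * Real.Gamma (n + α + 1) else 0) := by
  have he : (fun x : ℝ => (x ^ α * Real.exp (-x)) * (x ^ p * genLaguerre α n x)) =
      fun x => ∑ k ∈ Finset.range (n + 1),
        lagC α n k * ((x ^ α * Real.exp (-x)) * x ^ (k + p)) := by
    funext x
    rw [genLaguerre_eq, Finset.mul_sum, Finset.mul_sum]
    refine Finset.sum_congr rfl fun k _ => ?_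
    ring
  have hi : ∀ k ∈ Finset.range (n + 1), IntegrableOn
      (fun x => lagC α n k * ((x ^ α * Real.exp (-x)) * x ^ (k + p))) (Set.Ioi 0) :=
    fun k _ => ((aux_int_pow α hα (k + p)).1).const_mul _
  rw [he]
  refine ⟨integrable_finsetSum _ hi, fun hp => ?_⟩
  rw [integral_finsetSum _ hi]
  simp_rw [integral_const_mul, (aux_int_pow α hα _).2]
  have hn : (n.factorial : ℝ) ≠ 0 := by positivity
  have : ∀ k ∈ Finset.range (n + 1), lagC α n k * Real.Gamma (((k + p : ℕ) : ℝ) + α + 1) =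
      (Real.Gamma (n + α + 1) / n.factorial) *
        ((-1 : ℝ) ^ k * (n.choose k : ℝ) * (ascPochhammer ℝ p).eval ((α + 1) + k)) := by
    intro k hk
    have hk' : k ≤ n := Nat.lt_succ_iff.mp (Finset.mem_range.mp hk)
    have hpos : 0 < (α + 1) + (k : ℝ) := by
      have : (0:ℝ) ≤ k := by positivity
      linarith
    have h1 := aux_asc _ hpos p
    rw [show (((k + p : ℕ) : ℝ) + α + 1) = α + 1 + k + p by push_cast; ring, ← h1, lagC,
      Nat.cast_choose ℝ hk', show (k : ℝ) + α + 1 = α + 1 + k by ring]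
    have := (Real.Gamma_pos_of_pos hpos).ne'
    have : (k.factorial : ℝ) ≠ 0 := by positivity
    have : ((n - k).factorial : ℝ) ≠ 0 := by positivity
    field_simp
  rw [Finset.sum_congr rfl this, ← Finset.mul_sum, aux_sum _ _ _ hp]
  split_ifs
  · field_simp
  · simp

lemma aux_lag_lag_int (α : ℝ) (hα : -1 < α) (m n : ℕ) :
    IntegrableOn (fun x : ℝ => (x ^ α * Real.exp (-x)) * (genLaguerre α m x * genLaguerre α n x))
      (Set.Ioi 0) ∧
    (m ≤ n → ∫ x in Set.Ioi (0:ℝ),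
      (x ^ α * Real.exp (-x)) * (genLaguerre α m x * genLaguerre α n x) =
      if m = n then Real.Gamma (n + α + 1) / n.factorial else 0) := by
  have he : (fun x : ℝ => (x ^ α * Real.exp (-x)) * (genLaguerre α m x * genLaguerre α n x)) =
      fun x => ∑ k ∈ Finset.range (m + 1),
        lagC α m k * ((x ^ α * Real.exp (-x)) * (x ^ k * genLaguerre α n x)) := by
    funext x
    rw [genLaguerre_eq α m, Finset.sum_mul, Finset.mul_sum]
    refine Finset.sum_congr rfl fun k _ => ?_
    ring
  have hi : ∀ k ∈ Finset.range (m + 1), IntegrableOn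
      (fun x => lagC α m k * ((x ^ α * Real.exp (-x)) * (x ^ k * genLaguerre α n x)))
      (Set.Ioi 0) :=
    fun k _ => ((aux_int_pow_lag α hα n k).1).const_mul _
  rw [he]
  refine ⟨integrable_finsetSum _ hi, fun hp => ?_⟩
  rw [integral_finsetSum _ hi]
  simp_rw [integral_const_mul]
  have : ∀ k ∈ Finset.range (m + 1), lagC α m k * (∫ x in Set.Ioi (0:ℝ),
      (x ^ α * Real.exp (-x)) * (x ^ k * genLaguerre α n x)) =
      lagC α m k * (if k = n then (-1 : ℝ) ^ n * Real.Gamma (n + α + 1) else 0) := by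
    intro k hk
    have hk' : k ≤ m := Nat.lt_succ_iff.mp (Finset.mem_range.mp hk)
    rw [(aux_int_pow_lag α hα n k).2 (hk'.trans hp)]
  rw [Finset.sum_congr rfl this]
  split_ifs with h
  · subst h
    rw [Finset.sum_eq_single m (by intro b _ hb; simp [hb]) (by simp)]
    have hpos : 0 < (m : ℝ) + α + 1 := by
      have : (0:ℝ) ≤ m := by positivity
      linarith
    have h1 := (Real.Gamma_pos_of_pos hpos).ne'
    have h2 : (m.factorial : ℝ) ≠ 0 := by positivity
    have h3 : (-1 : ℝ) ^ m * (-1 : ℝ) ^ m = 1 := by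
      rw [← mul_pow]; norm_num
    simp only [lagC, if_true, Nat.sub_self, Nat.factorial_zero, Nat.cast_one, mul_one,
      div_self h1]
    field_simp
    linear_combination h3
  · refine Finset.sum_eq_zero fun k hk => ?_
    have : k ≠ n := by have := Finset.mem_range.mp hk; omega
    simp [this]

lemma lagPhi_int (α : ℝ) (hα : -1 < α) (m n : ℕ) :
    IntegrableOn (fun x : ℝ => (x ^ α * Real.exp (-x)) * (lagPhi α m x * lagPhi α n x))
      (Set.Ioi 0) := by
  have := ((aux_lag_lag_int α hα m n).1).const_mul
    (Real.sqrt ((Nat.factorial m : ℝ) / Real.Gamma (m + α + 1)) *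
      Real.sqrt ((Nat.factorial n : ℝ) / Real.Gamma (n + α + 1)))
  refine IntegrableOn.congr_fun this (fun x _ => ?_) measurableSet_Ioi
  simp only [lagPhi]; ring

lemma lagPhi_orth_aux (α : ℝ) (hα : -1 < α) (m n : ℕ) (hmn : m ≤ n) :
    ∫ x in Set.Ioi (0:ℝ), (x ^ α * Real.exp (-x)) * (lagPhi α m x * lagPhi α n x) =
      if m = n then 1 else 0 := by
  have h1 : ∀ x : ℝ, (x ^ α * Real.exp (-x)) * (lagPhi α m x * lagPhi α n x) =
    (Real.sqrt ((Nat.factorial m : ℝ) / Real.Gamma (m + α + 1)) *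
      Real.sqrt ((Nat.factorial n : ℝ) / Real.Gamma (n + α + 1))) *
      ((x ^ α * Real.exp (-x)) * (genLaguerre α m x * genLaguerre α n x)) := by
    intro x
    simp only [lagPhi]; ring
  simp_rw [h1, integral_const_mul, (aux_lag_lag_int α hα m n).2 hmn]
  split_ifs with h
  · subst h
    have hpos : 0 < (m : ℝ) + α + 1 := by
      have : (0:ℝ) ≤ m := by positivity
      linarith
    have h1 := (Real.Gamma_pos_of_pos hpos)
    have h2 : (m.factorial : ℝ) ≠ 0 := by positivity
    rw [Real.mul_self_sqrt (by positivity)]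
    field_simp
  · simp

lemma lagPhi_orth (α : ℝ) (hα : -1 < α) (m n : ℕ) :
    ∫ x in Set.Ioi (0:ℝ), (x ^ α * Real.exp (-x)) * (lagPhi α m x * lagPhi α n x) =
      if m = n then 1 else 0 := by
  rcases le_total m n with h | h
  · exact lagPhi_orth_aux α hα m n h
  · have := lagPhi_orth_aux α hα n m h
    simp_rw [mul_comm (lagPhi α n _)] at this
    rw [this]
    simp [eq_comm]

lemma lagPhi_abs_le (α : ℝ) (hα : -1 < α) (m n : ℕ) :
    ∫ x in Set.Ioi (0:ℝ), |(x ^ α * Real.exp (-x)) * (lagPhi α m x * lagPhi α n x)| ≤ 1 := by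
  have hm := lagPhi_orth α hα m m
  have hn := lagPhi_orth α hα n n
  simp only [if_true] at hm hn
  have : ∫ x in Set.Ioi (0:ℝ), (2⁻¹ * ((x ^ α * Real.exp (-x)) * (lagPhi α m x * lagPhi α m x)) +
      2⁻¹ * ((x ^ α * Real.exp (-x)) * (lagPhi α n x * lagPhi α n x))) = 1 := by
    rw [integral_add ((lagPhi_int α hα m m).const_mul _) ((lagPhi_int α hα n n).const_mul _),
      integral_const_mul, integral_const_mul, hm, hn]
    norm_num
  rw [← this]
  refine setIntegral_mono_on (lagPhi_int α hα m n).abs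
    (((lagPhi_int α hα m m).const_mul _).add ((lagPhi_int α hα n n).const_mul _))
    measurableSet_Ioi fun x hx => ?_
  have hw : 0 ≤ x ^ α * Real.exp (-x) :=
    mul_nonneg (Real.rpow_nonneg (le_of_lt hx) _) (Real.exp_pos _).le
  rw [abs_mul, abs_of_nonneg hw]
  have : |lagPhi α m x * lagPhi α n x| ≤
      2⁻¹ * (lagPhi α m x * lagPhi α m x) + 2⁻¹ * (lagPhi α n x * lagPhi α n x) := by
    rw [abs_le]
    constructor
    · nlinarith [sq_nonneg (lagPhi α m x + lagPhi α n x)]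
    · nlinarith [sq_nonneg (lagPhi α m x - lagPhi α n x)]
  calc _ ≤ _ := mul_le_mul_of_nonneg_left this hw
    _ = _ := by ring

lemma gamma_ratio (α : ℝ) (hα : -1 < α) (N : ℕ) (hN : α ≤ N) (j i : ℕ) :
    Real.Gamma ((j + i : ℕ) + α + 1) / Real.Gamma (j + α + 1) ≤
      ((j + i + N).factorial : ℝ) / ((j + N).factorial : ℝ) := by
  have hj : (0:ℝ) ≤ j := by positivity
  have h0 := Real.Gamma_pos_of_pos (show 0 < (j : ℝ) + α + 1 by linarith)
  induction i with
  | zero => simp only [add_zero]; rw [div_self h0.ne', div_self (by positivity)]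
  | succ i ih =>
    have hi : (0:ℝ) ≤ i := by positivity
    have h1 : 0 < ((j + i : ℕ) : ℝ) + α + 1 := by push_cast; linarith
    rw [show (((j + (i + 1) : ℕ) : ℝ) + α + 1) = (((j + i : ℕ) : ℝ) + α + 1) + 1 by
        push_cast; ring, Real.Gamma_add_one h1.ne',
      show j + (i + 1) + N = (j + i + N) + 1 by ring, Nat.factorial_succ, mul_div_assoc]
    push_cast at *
    rw [mul_div_assoc]
    have h3 := Real.Gamma_pos_of_pos h1
    refine mul_le_mul (by linarith) ih (by positivity) (by positivity)

lemma genLaguerre_bound (α y : ℝ) (hα : -1 < α) (hy : 0 ≤ y) (s : ℝ) (hs : 0 < s) :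
    ∃ C : ℝ, 0 ≤ C ∧ ∀ n : ℕ, |genLaguerre α n y| ≤ C * (1 + s) ^ n := by
  obtain ⟨N, hN⟩ := exists_nat_ge α
  refine ⟨(1 + s) ^ N / s ^ N * Real.exp (y / s), by positivity, fun n => ?_⟩
  have hterm : ∀ k ∈ Finset.range (n + 1), |lagC α n k * y ^ k| ≤
      (1 + s) ^ N / s ^ N * (1 + s) ^ n * ((y / s) ^ k / k.factorial) := by
    intro k hk
    obtain ⟨i, rfl⟩ := Nat.exists_eq_add_of_le (Nat.lt_succ_iff.mp (Finset.mem_range.mp hk))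
    have hk0 : (0:ℝ) ≤ k := by positivity
    have hi0 : (0:ℝ) ≤ i := by positivity
    have g1 := Real.Gamma_pos_of_pos (show 0 < (k : ℝ) + α + 1 by linarith)
    have g2 := Real.Gamma_pos_of_pos (show 0 < ((k + i : ℕ) : ℝ) + α + 1 by push_cast; linarith)
    have hr := gamma_ratio α hα N hN k i
    have hc : ((k + N + i).choose (k + N) : ℝ) * s ^ (k + N) ≤ (1 + s) ^ (k + N + i) := by
      rw [add_comm (1:ℝ) s, add_pow]
      have := Finset.single_le_sum (f := fun m => s ^ m * 1 ^ (k + N + i - m) *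
        ((k + N + i).choose m : ℝ)) (s := Finset.range (k + N + i + 1))
        (fun m _ => by positivity) (a := k + N) (Finset.mem_range.mpr (by omega))
      simp only [one_pow, mul_one] at this ⊢
      linarith
    have e1 : |lagC α (k + i) k * y ^ k| = (Real.Gamma ((k + i : ℕ) + α + 1) /
        Real.Gamma (k + α + 1)) / i.factorial * (y ^ k / k.factorial) := by
      simp only [lagC, Nat.add_sub_cancel_left]
      rw [abs_mul, abs_mul, abs_div, abs_pow, abs_neg, abs_one, one_pow,
        abs_of_nonneg (show (0:ℝ) ≤ y ^ k by positivity),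
        abs_of_nonneg (show (0:ℝ) ≤ k.factorial by positivity), abs_of_nonneg (by positivity)]
      field_simp
    rw [e1]
    have e2 : (((k + i + N).factorial : ℝ) / ((k + N).factorial : ℝ)) / i.factorial =
        ((k + N + i).choose (k + N) : ℝ) := by
      rw [Nat.cast_add_choose, show k + i + N = k + N + i by ring, div_div]
    calc _ ≤ ((k + N + i).choose (k + N) : ℝ) * (y ^ k / k.factorial) := by
            rw [← e2]; gcongr
      _ = (((k + N + i).choose (k + N) : ℝ) * s ^ (k + N)) *
          ((y ^ k / k.factorial) / s ^ (k + N)) := by field_simp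
      _ ≤ (1 + s) ^ (k + N + i) * ((y ^ k / k.factorial) / s ^ (k + N)) := by gcongr
      _ = _ := by rw [div_pow, pow_add, pow_add, pow_add, pow_add]; field_simp
  rw [genLaguerre_eq]
  calc _ ≤ ∑ k ∈ Finset.range (n + 1), |lagC α n k * y ^ k| := Finset.abs_sum_le_sum_abs _ _
    _ ≤ _ := Finset.sum_le_sum hterm
    _ = (1 + s) ^ N / s ^ N * (1 + s) ^ n *
        ∑ k ∈ Finset.range (n + 1), ((y / s) ^ k / k.factorial) := by rw [Finset.mul_sum]
    _ ≤ (1 + s) ^ N / s ^ N * (1 + s) ^ n * Real.exp (y / s) := by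
        gcongr
        exact Real.sum_le_exp_of_nonneg (by positivity) _
    _ = _ := by ring

lemma norm_bound (α : ℝ) (hα : -1 < α) :
    ∃ C : ℝ, 0 ≤ C ∧ ∀ n : ℕ,
      Real.sqrt ((Nat.factorial n : ℝ) / Real.Gamma (n + α + 1)) ≤ C * (n + 1) := by
  have hpos : ∀ n : ℕ, 0 < Real.Gamma (n + α + 1) := fun n => by
    have hn : (0:ℝ) ≤ n := by positivity
    exact Real.Gamma_pos_of_pos (by linarith)
  set c : ℕ → ℝ := fun n => (Nat.factorial n : ℝ) / Real.Gamma (n + α + 1) with hc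
  have hcpos : ∀ n, 0 < c n := fun n => div_pos (by positivity) (hpos n)
  have hstep : ∀ n : ℕ, c (n + 1) ≤ c 1 * (n + 1) := by
    intro n
    induction n with
    | zero => simp
    | succ n ih =>
      have hn : (0:ℝ) ≤ n := by positivity
      have e : c (n + 1 + 1) = (n + 2) / (n + 2 + α) * c (n + 1) := by
        simp only [hc]
        have h1 : 0 < ((n + 1 : ℕ) : ℝ) + α + 1 := by push_cast; linarith
        rw [Nat.factorial_succ (n + 1), show (((n + 1 + 1 : ℕ) : ℝ) + α + 1) =
          (((n + 1 : ℕ) : ℝ) + α + 1) + 1 by push_cast; ring, Real.Gamma_add_one h1.ne']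
        have := (hpos (n + 1)).ne'
        push_cast at *
        have h3 : (n : ℝ) + 2 + α ≠ 0 := by linarith
        field_simp
        ring
      rw [e]
      have h3 : 0 < (n : ℝ) + 2 + α := by linarith
      have h4 := hcpos 1
      calc _ ≤ ((n : ℝ) + 2) / (n + 2 + α) * (c 1 * (n + 1)) := by gcongr
        _ = c 1 * (n + 2) * ((n + 1) / (n + 2 + α)) := by field_simp
        _ ≤ c 1 * (n + 2) * 1 := by
          gcongr
          rw [div_le_one h3]; linarith
        _ = _ := by push_cast; ring
  have hall : ∀ n : ℕ, c n ≤ (c 0 + c 1) * (n + 1) := by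
    intro n
    have h0 := hcpos 0
    have h1 := hcpos 1
    cases n with
    | zero => simp; linarith
    | succ n => 
      have := hstep n
      have hn : (0:ℝ) ≤ n := by positivity
      push_cast
      nlinarith
  refine ⟨1 + (c 0 + c 1), by linarith [hcpos 0, hcpos 1], fun n => ?_⟩
  have h1 : Real.sqrt (c n) ≤ 1 + c n := by
    rw [Real.sqrt_le_iff]
    have := hcpos n
    constructor <;> nlinarith
  have hn : (0:ℝ) ≤ n := by positivity
  have := hall n
  calc _ ≤ _ := h1
    _ ≤ _ := by nlinarith

lemma summable_lagPhi (α y : ℝ) (hα : -1 < α) (hy : 0 ≤ y) (r : ℝ) (hr0 : 0 ≤ r) (hr : r < 1) :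
    Summable (fun n : ℕ => |lagPhi α n y| * r ^ n) := by
  obtain ⟨s, hs, hsr⟩ : ∃ s : ℝ, 0 < s ∧ (1 + s) * r < 1 := by
    refine ⟨(1 - r) / 2, by linarith, by nlinarith⟩
  obtain ⟨C, hC, hC'⟩ := genLaguerre_bound α y hα hy s hs
  obtain ⟨D, hD, hD'⟩ := norm_bound α hα
  have hq : ‖(1 + s) * r‖ < 1 := by
    rw [Real.norm_of_nonneg (by positivity)]; exact hsr
  have h1 := summable_pow_mul_geometric_of_norm_lt_one 1 hq
  have h2 := summable_geometric_of_norm_lt_one hq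
  refine Summable.of_nonneg_of_le (fun n => by positivity) (fun n => ?_)
    ((h1.add h2).mul_left (D * C))
  rw [lagPhi, abs_mul, abs_of_nonneg (Real.sqrt_nonneg _)]
  calc _ ≤ (D * (n + 1)) * (C * (1 + s) ^ n) * r ^ n := by
        gcongr
        · exact hD' n
        · exact hC' n
    _ = _ := by rw [mul_pow]; ring

lemma Sdual_eq_s13 (α y : ℝ) (hα : -1 < α) (hy : 0 ≤ y) (n : ℕ) (q : ℍ[ℝ]) (hq : ‖q‖ < 1) :
    Sdual α y (fun x => (lagPhi α n x : ℍ[ℝ])) q = lagPhi α n y • q ^ n := by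
  set F : ℕ → ℝ → ℍ[ℝ] := fun k x =>
    ((x ^ α * Real.exp (-x)) * (lagPhi α k x * lagPhi α n x)) • (lagPhi α k y • q ^ k) with hF
  have hFi : ∀ k, Integrable (F k) (volume.restrict (Set.Ioi 0)) := fun k =>
    (lagPhi_int α hα k n).smul_const _
  have hS : Summable fun k => ∫ x in Set.Ioi (0:ℝ), ‖F k x‖ := by
    refine Summable.of_nonneg_of_le (fun k => integral_nonneg fun x => norm_nonneg _) (fun k => ?_)
      (summable_lagPhi α y hα hy ‖q‖ (norm_nonneg _) hq)
    simp only [hF, norm_smul, norm_pow, Real.norm_eq_abs]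
    rw [integral_mul_const]
    have := lagPhi_abs_le α hα k n
    simp only [abs_mul] at this ⊢
    exact mul_le_of_le_one_left (by positivity) this
  have key := hasSum_integral_of_summable_integral_norm hFi hS
  have e1 : Sdual α y (fun x => (lagPhi α n x : ℍ[ℝ])) q =
      ∫ x in Set.Ioi (0:ℝ), ∑' k, F k x := by
    rw [Sdual]
    congr 1
    funext x
    rw [Rker, ← tsum_mul_right, ← tsum_const_smul'']
    congr 1
    funext k
    simp only [hF]
    rw [← Quaternion.coe_commutes, Quaternion.coe_mul_eq_smul, smul_smul, smul_smul, smul_smul]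
    congr 1
    ring
  have e2 : ∀ k, ∫ x in Set.Ioi (0:ℝ), F k x = if k = n then lagPhi α n y • q ^ n else 0 := by
    intro k
    simp only [hF]
    rw [integral_smul_const, lagPhi_orth α hα k n]
    split_ifs with h
    · subst h; simp
    · simp
  rw [e1, ← key.tsum_eq]
  simp_rw [e2]
  simp

lemma beta_int (a b : ℝ) (ha : 0 < a) (hb : 0 < b) :
    ∫ x in Set.Ioo (0:ℝ) 1, x ^ (a - 1) * (1 - x) ^ (b - 1) =
      Real.Gamma a * Real.Gamma b / Real.Gamma (a + b) := by
  have h := ProbabilityTheory.beta_eq_betaIntegralReal a b ha hb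
  rw [ProbabilityTheory.beta] at h
  rw [h, Complex.betaIntegral, intervalIntegral.integral_of_le (by norm_num),
      ← integral_Ioc_eq_integral_Ioo, ← RCLike.re_to_complex, ← integral_re]
  · refine setIntegral_congr_fun measurableSet_Ioc fun x ⟨hx1, hx₂⟩ ↦ ?_
    norm_cast
    rw [← Complex.ofReal_cpow, ← Complex.ofReal_cpow, RCLike.re_to_complex,
      Complex.re_mul_ofReal, Complex.ofReal_re]
    all_goals linarith
  convert! Complex.betaIntegral_convergent (u := a) (v := b) (by simpa) (by simpa)
  rw [intervalIntegrable_iff_integrableOn_Ioc_of_le (by simp), IntegrableOn]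

lemma radial_int (β η : ℝ) (hβ : 0 < β) (hη : 0 < η) (n : ℕ) :
    ∫ r in Set.Ioi (0:ℝ), (if r < 1 then r * (weightBeta β η (r ^ 2) * r ^ (n + n)) else 0) =
      2⁻¹ * gamCoef β η n := by
  have hn : (0:ℝ) ≤ n := by positivity
  set g : ℝ → ℝ := (Set.Ioo (0:ℝ) 1).indicator
    (fun t => t ^ (β + n - 1) * (1 - t) ^ (η - 1)) with hg
  have h1 := integral_comp_rpow_Ioi g (p := 2) (by norm_num)
  have h2 : ∫ y in Set.Ioi (0:ℝ), g y = gamCoef β η n := by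
    rw [hg, setIntegral_indicator measurableSet_Ioo,
      Set.inter_eq_right.mpr (fun x hx => hx.1), beta_int _ _ (by linarith) hη, gamCoef,
      mul_comm (Real.Gamma η), show β + n + η = β + η + n by ring]
  rw [← h2, ← h1, ← integral_const_mul]
  refine setIntegral_congr_fun measurableSet_Ioi fun r hr => ?_
  have hr0 : 0 < r := hr
  have e2 : r ^ (2:ℝ) = r ^ 2 := by norm_cast
  simp only [e2, smul_eq_mul, hg]
  rw [show (2:ℝ) - 1 = 1 by norm_num, Real.rpow_one, abs_of_pos (by norm_num : (0:ℝ) < 2)]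
  split_ifs with h
  · rw [Set.indicator_of_mem (show r ^ 2 ∈ Set.Ioo (0:ℝ) 1 from ⟨by positivity, by nlinarith⟩),
      weightBeta, show β + n - 1 = (β - 1) + n by ring,
      Real.rpow_add (by positivity : 0 < r ^ 2), Real.rpow_natCast]
    ring
  · rw [Set.indicator_of_notMem]
    · simp
    · rintro ⟨_, h'⟩
      exact h (by nlinarith)

lemma angular_int (m n : ℕ) :
    ∫ θ in Set.Ioo (-π) π, Complex.exp (((n : ℂ) - m) * Complex.I * θ) =
      if m = n then ((2 * π : ℝ) : ℂ) else 0 := by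
  rw [← integral_Ioc_eq_integral_Ioo, ← intervalIntegral.integral_of_le (by linarith [pi_pos])]
  split_ifs with h
  · subst h
    simp
    ring
  · have hc : ((n : ℂ) - m) * Complex.I ≠ 0 := by
      refine mul_ne_zero (sub_ne_zero.mpr ?_) Complex.I_ne_zero
      exact_mod_cast (Ne.symm h)
    rw [integral_exp_mul_complex hc]
    have : Complex.exp (((n : ℂ) - m) * Complex.I * π) =
        Complex.exp (((n : ℂ) - m) * Complex.I * (-π : ℝ)) := by
      rw [Complex.exp_eq_exp_iff_exists_int]
      refine ⟨(n : ℤ) - m, ?_⟩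
      push_cast
      ring
    rw [this]; simp

lemma disc_int (β η : ℝ) (hβ : 0 < β) (hη : 0 < η) (m n : ℕ) :
    ∫ p in {p : ℝ × ℝ | p.1 ^ 2 + p.2 ^ 2 < 1},
      weightBeta β η (p.1 ^ 2 + p.2 ^ 2) •
        ((starRingEnd ℂ) (⟨p.1, p.2⟩ : ℂ) ^ m * (⟨p.1, p.2⟩ : ℂ) ^ n) =
      (((if m = n then (1 : ℝ) else 0) * (π * gamCoef β η n) : ℝ) : ℂ) := by
  have hms : MeasurableSet {p : ℝ × ℝ | p.1 ^ 2 + p.2 ^ 2 < 1} :=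
    (isOpen_lt (by fun_prop) (by fun_prop)).measurableSet
  rw [← integral_indicator hms, ← integral_comp_polarCoord_symm]
  have e : Set.EqOn (fun p : ℝ × ℝ => p.1 • ({p : ℝ × ℝ | p.1 ^ 2 + p.2 ^ 2 < 1}).indicator
      (fun p : ℝ × ℝ => weightBeta β η (p.1 ^ 2 + p.2 ^ 2) •
        ((starRingEnd ℂ) (⟨p.1, p.2⟩ : ℂ) ^ m * (⟨p.1, p.2⟩ : ℂ) ^ n)) (polarCoord.symm p))
      (fun p : ℝ × ℝ =>
        (if p.1 < 1 then p.1 * (weightBeta β η (p.1 ^ 2) * p.1 ^ (m + n)) else 0) •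
        Complex.exp (((n : ℂ) - m) * Complex.I * p.2)) polarCoord.target := by
    rintro ⟨r, θ⟩ hp
    have hr : 0 < r := hp.1
    have hsq : (r * Real.cos θ) ^ 2 + (r * Real.sin θ) ^ 2 = r ^ 2 := by
      linear_combination r ^ 2 * Real.sin_sq_add_cos_sq θ
    have hz : (⟨r * Real.cos θ, r * Real.sin θ⟩ : ℂ) = r * Complex.exp (Complex.I * θ) := by
      rw [mul_comm Complex.I, Complex.exp_mul_I, ← Complex.ofReal_cos, ← Complex.ofReal_sin]
      apply Complex.ext <;> simp [← Complex.ofReal_cos, ← Complex.ofReal_sin, -Complex.ofReal_cos, -Complex.ofReal_sin]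
    have hz' : (starRingEnd ℂ) (⟨r * Real.cos θ, r * Real.sin θ⟩ : ℂ) =
        r * Complex.exp (-(Complex.I * θ)) := by
      rw [hz, map_mul, Complex.conj_ofReal, ← Complex.exp_conj]
      simp
    simp only [polarCoord_symm_apply, Set.indicator_apply, Set.mem_ofPred_eq, hsq]
    have hiff : r ^ 2 < 1 ↔ r < 1 := by
      constructor <;> intro h <;> nlinarith
    simp only [hiff]
    split_ifs with h
    · rw [hz', hz, mul_pow, mul_pow, ← Complex.exp_nat_mul, ← Complex.exp_nat_mul,
        show ((n : ℂ) - m) * Complex.I * θ = m * (-(Complex.I * θ)) + n * (Complex.I * θ) by ring,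
        Complex.exp_add]
      simp only [Complex.real_smul]
      push_cast
      ring
    · simp
  rw [setIntegral_congr_fun polarCoord.open_target.measurableSet e, polarCoord_target,
    Measure.volume_eq_prod, ← Measure.prod_restrict,
    integral_prod_smul
      (fun r : ℝ => if r < 1 then r * (weightBeta β η (r ^ 2) * r ^ (m + n)) else 0)
      (fun θ : ℝ => Complex.exp (((n : ℂ) - m) * Complex.I * θ)), angular_int]
  split_ifs with h
  · subst h
    rw [radial_int β η hβ hη, Complex.real_smul, ← Complex.ofReal_mul]
    congr 1
    ring
  · simp

lemma emb_exists (I : ℍ[ℝ]) (hI : I ^ 2 = -1) : ∃ f : ℂ →ₐ[ℝ] ℍ[ℝ],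
    (∀ u v : ℝ, f ⟨u, v⟩ = (u : ℍ[ℝ]) + v • I) ∧ (∀ z, star (f z) = f ((starRingEnd ℂ) z)) ∧
    (∀ z, ‖f z‖ = ‖z‖) := by
  have hn : ‖I‖ = 1 := by
    have h := congrArg norm hI
    rw [norm_pow, norm_neg, norm_one] at h
    exact (pow_eq_one_iff_of_nonneg (norm_nonneg _) two_ne_zero).mp h
  have hre : I.re = 0 := by
    rw [← Quaternion.sq_eq_neg_normSq, hI, Quaternion.normSq_eq_norm_mul_self, hn]
    simp
  have hst : star I = -I := Quaternion.star_eq_neg.mpr hre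
  have hf : ∀ u v : ℝ, Complex.lift ⟨I, by rw [← sq, hI]⟩ ⟨u, v⟩ = (u : ℍ[ℝ]) + v • I := by
    intro u v
    simp [Complex.lift, Complex.liftAux_apply]
  refine ⟨Complex.lift ⟨I, by rw [← sq, hI]⟩, hf, ?_, ?_⟩
  · rintro ⟨u, v⟩
    have : (starRingEnd ℂ) (⟨u, v⟩ : ℂ) = ⟨u, -v⟩ := rfl
    rw [this, hf, hf]
    simp [hst]
  · have hs : ∀ z, star (Complex.lift ⟨I, by rw [← sq, hI]⟩ z : ℍ[ℝ]) =
        Complex.lift ⟨I, by rw [← sq, hI]⟩ ((starRingEnd ℂ) z) := by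
      rintro ⟨u, v⟩
      have : (starRingEnd ℂ) (⟨u, v⟩ : ℂ) = ⟨u, -v⟩ := rfl
      rw [this, hf, hf]
      simp [hst]
    intro z
    have h1 : ((‖(Complex.lift ⟨I, by rw [← sq, hI]⟩ z : ℍ[ℝ])‖ *
        ‖(Complex.lift ⟨I, by rw [← sq, hI]⟩ z : ℍ[ℝ])‖ : ℝ) : ℍ[ℝ]) = ((‖z‖ * ‖z‖ : ℝ) : ℍ[ℝ]) := by
      rw [← Quaternion.normSq_eq_norm_mul_self, ← Quaternion.self_mul_star, hs, ← map_mul,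
        Complex.mul_conj, Complex.normSq_eq_norm_sq, ← pow_two ‖z‖]
      exact AlgHom.commutes _ _
    have h2 := Quaternion.coe_injective h1
    nlinarith [norm_nonneg z, norm_nonneg (Complex.lift ⟨I, by rw [← sq, hI]⟩ z : ℍ[ℝ]),
      mul_self_inj (norm_nonneg _) (norm_nonneg _) |>.mp h2]

/-- Orthogonality of the images of the Laguerre basis (Proposition propsv): the
singular values of `S_y^α` are `(π γ_n^{β,η})^{1/2} |φ_n^α(y)|`. -/
theorem stmt_13 (α β η y : ℝ) (hα : -1 < α) (hβ : 0 < β) (hη : 0 < η) (hy : 0 ≤ y)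
    (I : ℍ[ℝ]) (hI : I ^ 2 = -1) (m n : ℕ) :
    (∫ p in {p : ℝ × ℝ | p.1 ^ 2 + p.2 ^ 2 < 1},
      weightBeta β η (p.1 ^ 2 + p.2 ^ 2) •
        (star (Sdual α y (fun x => (lagPhi α m x : ℍ[ℝ])) ((p.1 : ℍ[ℝ]) + p.2 • I)) *
          Sdual α y (fun x => (lagPhi α n x : ℍ[ℝ])) ((p.1 : ℍ[ℝ]) + p.2 • I))) =
    (((if m = n then (1 : ℝ) else 0) * (π * gamCoef β η n * (lagPhi α n y) ^ 2) : ℝ) : ℍ[ℝ]) := by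
  obtain ⟨f, hf, hfs, hfn⟩ := emb_exists I hI
  have hms : MeasurableSet {p : ℝ × ℝ | p.1 ^ 2 + p.2 ^ 2 < 1} :=
    (isOpen_lt (by fun_prop) (by fun_prop)).measurableSet
  let L : ℂ →ₗᵢ[ℝ] ℍ[ℝ] := ⟨f.toLinearMap, hfn⟩
  have hL : ∀ z, L z = f z := fun z => rfl
  have e : Set.EqOn (fun p : ℝ × ℝ => weightBeta β η (p.1 ^ 2 + p.2 ^ 2) •
        (star (Sdual α y (fun x => (lagPhi α m x : ℍ[ℝ])) ((p.1 : ℍ[ℝ]) + p.2 • I)) *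
          Sdual α y (fun x => (lagPhi α n x : ℍ[ℝ])) ((p.1 : ℍ[ℝ]) + p.2 • I)))
      (fun p : ℝ × ℝ => (lagPhi α m y * lagPhi α n y) •
        L (weightBeta β η (p.1 ^ 2 + p.2 ^ 2) •
        ((starRingEnd ℂ) (⟨p.1, p.2⟩ : ℂ) ^ m * (⟨p.1, p.2⟩ : ℂ) ^ n)))
      {p : ℝ × ℝ | p.1 ^ 2 + p.2 ^ 2 < 1} := by
    rintro ⟨u, v⟩ hp
    have hp' : u ^ 2 + v ^ 2 < 1 := hp
    have hq : ‖f ⟨u, v⟩‖ < 1 := by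
      rw [hfn, Complex.norm_def, Complex.normSq_mk, Real.sqrt_lt' one_pos]
      linarith
    simp only [hL]
    rw [← hf, Sdual_eq_s13 α y hα hy m _ hq, Sdual_eq_s13 α y hα hy n _ hq, map_smul, map_mul, map_pow,
      map_pow, ← hfs, Quaternion.star_smul, star_pow, smul_mul_smul_comm, smul_smul, smul_smul]
    congr 1
    ring
  rw [setIntegral_congr_fun hms e, integral_smul, L.integral_comp_comm, disc_int β η hβ hη m n, hL,
    show f ((((if m = n then (1 : ℝ) else 0) * (π * gamCoef β η n) : ℝ) : ℂ)) =
      (((if m = n then (1 : ℝ) else 0) * (π * gamCoef β η n) : ℝ) : ℍ[ℝ]) from f.commutes _,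
    ← Quaternion.coe_mul_eq_smul, ← Quaternion.coe_mul]
  congr 1
  split_ifs with h
  · subst h; ring
  · simp
end
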